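/- arXiv:1505.06429 — 2 statements merged into one kernel-verified Lean document; each statement's English description precedes it below -/
import Mathlib

section
/- For any fixed integer n ≥ 2, as V → ∞ one has N_n(V) = (ϑ_n/n)·V^n + o(V^n); that is, the limit of N_n(V)·n/V^n as V → ∞ equals ϑ_n. -/
open Filter

/-- `ϑ_n`: the product over all primes `p` of `1 + (p^(n-1) - 1)/(p^(n+1) - p^n)`. -/
noncomputable def thetaN (n : ℕ) : ℝ :=
  ∏' p : Nat.Primes, (1 + ((p : ℝ) ^ (n - 1) - 1) / ((p : ℝ) ^ (n + 1) - (p : ℝ) ^ n))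

/-- `N_n(V)`: the number of finite-index subgroups `L ⊆ ℤ^n` with `[ℤ^n : L] ≤ V`
such that `ℤ^n/L` is cyclic. -/
noncomputable def cocyclicCount (n : ℕ) (V : ℝ) : ℕ :=
  Set.ncard {L : AddSubgroup (Fin n → ℤ) |
    L.index ≠ 0 ∧ (L.index : ℝ) ≤ V ∧ IsAddCyclic ((Fin n → ℤ) ⧸ L)}


lemma fiber_equiv {G : Type*} [AddCommGroup G] {m : ℕ}
    (L : AddSubgroup G) (hL : L.index = m ∧ IsAddCyclic (G ⧸ L)) :
    Nonempty ({f : {f : G →+ ZMod m // Function.Surjective f} // f.1.ker = L} ≃ (ZMod m)ˣ) := by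
  obtain ⟨hi, hc⟩ := hL
  have hcard : Nat.card (G ⧸ L) = m := hi
  have e0 : (G ⧸ L) ≃+ ZMod m := (hcard ▸ (zmodAddCyclicAddEquiv hc).symm)
  have e1 : (G ⧸ L ≃+ ZMod m) ≃ AddAut (ZMod m) :=
    { toFun := fun e => e0.symm.trans e
      invFun := fun a => e0.trans a
      left_inv := fun e => by ext x; simp
      right_inv := fun e => by ext x; simp }
  have e2 : AddAut (ZMod m) ≃ (ZMod m)ˣ := (ZMod.AddAutEquivUnits m).toEquiv.trans Additive.toMul
  let F : (G ⧸ L ≃+ ZMod m) →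
      {f : {f : G →+ ZMod m // Function.Surjective f} // f.1.ker = L} := fun e =>
    ⟨⟨e.toAddMonoidHom.comp (QuotientAddGroup.mk' L),
      e.surjective.comp (QuotientAddGroup.mk'_surjective L)⟩, by
        ext x
        simp⟩
  have hF : Function.Bijective F := by
    constructor
    · intro e e' h
      ext x
      obtain ⟨x, rfl⟩ := QuotientAddGroup.mk'_surjective L x
      exact DFunLike.congr_fun (congrArg (fun f => f.1.1) h) x
    · rintro ⟨⟨f, hf⟩, h⟩
      refine ⟨(QuotientAddGroup.quotientAddEquivOfEq h.symm).trans
        (QuotientAddGroup.quotientKerEquivOfSurjective f hf), ?_⟩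
      apply Subtype.ext
      apply Subtype.ext
      ext x
      rfl
  exact ⟨((Equiv.ofBijective F hF).symm.trans e1).trans e2⟩

lemma surj_equiv {G : Type*} [AddCommGroup G] {m : ℕ} (hm : m ≠ 0) :
    Nonempty ({f : G →+ ZMod m // Function.Surjective f} ≃
      {L : AddSubgroup G // L.index = m ∧ IsAddCyclic (G ⧸ L)} × (ZMod m)ˣ) := by
  have : NeZero m := ⟨hm⟩
  let k : {f : G →+ ZMod m // Function.Surjective f} →
      {L : AddSubgroup G // L.index = m ∧ IsAddCyclic (G ⧸ L)} := fun f =>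
    ⟨f.1.ker, by
      rw [AddSubgroup.index_ker]
      rw [AddMonoidHom.range_eq_top.2 f.2]
      simp, by
      have e := QuotientAddGroup.quotientKerEquivOfSurjective f.1 f.2
      exact isAddCyclic_of_surjective e.symm e.symm.surjective⟩
  have hk : ∀ L, Nonempty ({f // k f = L} ≃ (ZMod m)ˣ) := by
    intro L
    obtain ⟨e⟩ := fiber_equiv L.1 L.2
    refine ⟨(Equiv.subtypeEquivRight ?_).trans e⟩
    intro f
    exact Subtype.ext_iff
  let ek := fun L => (hk L).some
  exact ⟨(Equiv.sigmaFiberEquiv k).symm.trans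
    ((Equiv.sigmaCongrRight ek).trans (Equiv.sigmaEquivProd _ _))⟩

/-- homs from `ℤ^n` are vectors -/
noncomputable def homEquiv (n m : ℕ) : (Fin n → ZMod m) ≃ ((Fin n → ℤ) →+ ZMod m) :=
  ((Pi.basisFun ℤ (Fin n)).constr ℤ).toEquiv.trans (addMonoidHomLequivInt ℤ).symm.toEquiv

lemma homEquiv_apply (n m : ℕ) (x : Fin n → ZMod m) (v : Fin n → ℤ) :
    homEquiv n m x v = ∑ i, v i • x i := by
  simp [homEquiv, Module.Basis.constr_apply_fintype]

lemma homEquiv_surj (n m : ℕ) (hm : m ≠ 0) (x : Fin n → ZMod m) :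
    Function.Surjective (homEquiv n m x) ↔
      ∀ p ∈ m.primeFactors, ∃ i, ¬ p ∣ (x i).val := by
  have : NeZero m := ⟨hm⟩
  constructor
  · intro h p hp
    by_contra! hall
    obtain ⟨v, hv⟩ := h 1
    rw [homEquiv_apply] at hv
    have hpm := Nat.dvd_of_mem_primeFactors hp
    have hpp := Nat.prime_of_mem_primeFactors hp
    have : Fact p.Prime := ⟨hpp⟩
    have := congrArg (ZMod.castHom hpm (ZMod p)) hv
    rw [map_sum, map_one] at this
    rw [Finset.sum_eq_zero] at this
    · exact zero_ne_one this
    · intro i _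
      rw [map_zsmul]
      have : ZMod.castHom hpm (ZMod p) (x i) = 0 := by
        rw [← ZMod.natCast_zmod_val (x i), map_natCast]
        exact (ZMod.natCast_eq_zero_iff _ _).2 (hall i)
      simp [this]
  · intro h
    obtain ⟨d, hd⟩ := Int.subgroup_cyclic ((homEquiv n m x).range.comap (Int.castAddHom (ZMod m)))
    rw [← AddSubgroup.zmultiples_eq_closure] at hd
    have hdm : d ∣ (m : ℤ) := by
      rw [← Int.mem_zmultiples_iff, ← hd]
      simp
    have hdx : ∀ i, d ∣ ((x i).val : ℤ) := by
      intro i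
      rw [← Int.mem_zmultiples_iff, ← hd]
      refine ⟨Pi.single i 1, ?_⟩
      rw [homEquiv_apply]
      simp [Pi.single_apply]
    have hd1 : d.natAbs = 1 := by
      by_contra hne
      obtain ⟨p, hp, hpd⟩ := Nat.exists_prime_and_dvd hne
      obtain ⟨i, hi⟩ := h p (Nat.mem_primeFactors.2
        ⟨hp, hpd.trans (Int.natAbs_dvd_natAbs.2 hdm), hm⟩)
      exact hi (hpd.trans (Int.natAbs_dvd_natAbs.2 (hdx i)))
    have h1 : (1 : ℤ) ∈ (homEquiv n m x).range.comap (Int.castAddHom (ZMod m)) := by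
      rw [hd, Int.mem_zmultiples_iff]
      exact Int.natAbs_dvd_natAbs.1 (by simp [hd1])
    have h2 : (1 : ZMod m) ∈ (homEquiv n m x).range := by simpa using h1
    intro y
    have h3 := AddSubgroup.nsmul_mem _ h2 y.val
    simpa using h3

lemma card_dvd (m d : ℕ) [NeZero m] (hd : d ∣ m) :
    (Finset.univ.filter (fun x : ZMod m => d ∣ x.val)).card = m / d := by
  obtain ⟨k, rfl⟩ := hd
  have hdk : d * k ≠ 0 := NeZero.ne _
  have hd0 : 0 < d := Nat.pos_of_ne_zero (left_ne_zero_of_mul hdk)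
  rw [Nat.mul_div_cancel_left _ hd0]
  conv_rhs => rw [← Finset.card_range k]
  refine Finset.card_nbij' (fun x => x.val / d) (fun e => ((d * e : ℕ) : ZMod (d * k))) ?_ ?_ ?_ ?_
  · intro x hx
    have := ZMod.val_lt x
    simp only [Finset.coe_range, Set.mem_Iio]
    exact Nat.div_lt_of_lt_mul this
  · intro e he
    simp only [Finset.coe_range, Set.mem_Iio] at he
    simp only [Finset.coe_filter, Finset.mem_univ, true_and, Set.mem_ofPred_eq]
    rw [ZMod.val_natCast_of_lt (Nat.mul_lt_mul_of_pos_left he hd0)]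
    exact dvd_mul_right _ _
  · intro x hx
    simp only [Finset.coe_filter, Finset.mem_univ, true_and, Set.mem_ofPred_eq] at hx
    simp only
    rw [Nat.mul_div_cancel' hx, ZMod.natCast_zmod_val]
  · intro e he
    simp only [Finset.coe_range, Set.mem_Iio] at he
    simp only
    rw [ZMod.val_natCast_of_lt (Nat.mul_lt_mul_of_pos_left he hd0), Nat.mul_div_cancel_left _ hd0]

lemma card_surj (n m : ℕ) (hm : m ≠ 0) :
    (Nat.card {f : (Fin n → ℤ) →+ ZMod m // Function.Surjective f} : ℝ) =
      (m : ℝ) ^ n * ∏ p ∈ m.primeFactors, (1 - ((p : ℝ) ^ n)⁻¹) := by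
  classical
  have : NeZero m := ⟨hm⟩
  let S : ℕ → Finset (Fin n → ZMod m) := fun p => Finset.univ.filter (fun x => ∀ i, p ∣ (x i).val)
  have h1 : Nat.card {f : (Fin n → ℤ) →+ ZMod m // Function.Surjective f} =
      (m.primeFactors.inf fun p => (S p)ᶜ).card := by
    rw [← Nat.card_congr ((homEquiv n m).subtypeEquiv (p := fun x =>
      x ∈ (m.primeFactors.inf fun p => (S p)ᶜ)) ?_)]
    · simp
    · intro x
      rw [homEquiv_surj n m hm x]
      simp [S, Finset.mem_inf]
  have h2 : ∀ t ∈ m.primeFactors.powerset, ((t.inf S).card : ℝ) = (m : ℝ) ^ n * ∏ p ∈ t, ((p : ℝ) ^ n)⁻¹ := by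
    intro t ht
    rw [Finset.mem_powerset] at ht
    have hdm : (∏ p ∈ t, p) ∣ m :=
      (Finset.prod_dvd_prod_of_subset _ _ _ ht).trans (Nat.prod_primeFactors_dvd m)
    have : t.inf S = Fintype.piFinset (fun _ : Fin n =>
        Finset.univ.filter (fun x : ZMod m => (∏ p ∈ t, p) ∣ x.val)) := by
      ext x
      simp only [Finset.mem_inf, S, Finset.mem_filter, Finset.mem_univ, true_and,
        Fintype.mem_piFinset]
      constructor
      · intro h i
        exact Finset.prod_primes_dvd _ (fun p hp => (Nat.prime_of_mem_primeFactors (ht hp)).prime)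
          (fun p hp => h p hp i)
      · intro h p hp i
        exact (Finset.dvd_prod_of_mem _ hp).trans (h i)
    rw [this, Fintype.card_piFinset]
    simp only [card_dvd m _ hdm, Finset.prod_const, Finset.card_univ, Fintype.card_fin]
    have hne : ((∏ p ∈ t, p : ℕ) : ℝ) ≠ 0 := by
      exact_mod_cast ne_zero_of_dvd_ne_zero hm hdm
    rw [Nat.cast_pow, Nat.cast_div hdm hne, div_pow, Finset.prod_inv_distrib, Finset.prod_pow,
      Nat.cast_prod, div_eq_mul_inv]
  have h3 := Finset.inclusion_exclusion_card_inf_compl m.primeFactors S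
  have h4 := congrArg (Int.cast : ℤ → ℝ) h3
  push_cast at h4
  rw [h1, h4]
  have h5 : ∏ p ∈ m.primeFactors, (1 - ((p : ℝ) ^ n)⁻¹) =
      ∑ t ∈ m.primeFactors.powerset, (-1 : ℝ) ^ t.card * ∏ p ∈ t, ((p : ℝ) ^ n)⁻¹ := by
    simp_rw [sub_eq_add_neg, Finset.prod_one_add, Finset.prod_neg]
  rw [h5, Finset.mul_sum]
  refine Finset.sum_congr rfl fun t ht => ?_
  rw [h2 t ht]
  ring

/-- local factor -/
noncomputable def hfac (n p : ℕ) : ℝ := ((p : ℝ) ^ (n - 1) - 1) / ((p : ℝ) ^ n - (p : ℝ) ^ (n - 1))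

lemma finite_L (n m : ℕ) (hm : m ≠ 0) :
    Set.Finite {L : AddSubgroup (Fin n → ℤ) | L.index = m ∧ IsAddCyclic ((Fin n → ℤ) ⧸ L)} := by
  have : NeZero m := ⟨hm⟩
  obtain ⟨e⟩ := surj_equiv (G := Fin n → ℤ) hm
  have : Finite ((Fin n → ℤ) →+ ZMod m) := Finite.of_equiv _ (homEquiv n m)
  have : Function.Surjective (fun f => (e f).1) := Prod.fst_surjective.comp e.surjective
  exact Finite.of_surjective _ this

lemma card_L (n m : ℕ) (hn : 2 ≤ n) (hm : m ≠ 0) :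
    (Set.ncard {L : AddSubgroup (Fin n → ℤ) | L.index = m ∧ IsAddCyclic ((Fin n → ℤ) ⧸ L)} : ℝ)
      = (m : ℝ) ^ (n - 1) * ∏ p ∈ m.primeFactors, (1 + hfac n p) := by
  have : NeZero m := ⟨hm⟩
  obtain ⟨e⟩ := surj_equiv (G := Fin n → ℤ) hm
  have h1 := Nat.card_congr e
  rw [Nat.card_prod, Nat.card_eq_fintype_card (α := (ZMod m)ˣ), ZMod.card_units_eq_totient] at h1
  have h2 := congrArg (Nat.cast : ℕ → ℝ) h1
  rw [card_surj n m hm, Nat.cast_mul] at h2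
  have h3 : (m.totient : ℝ) = m * ∏ p ∈ m.primeFactors, (1 - (p : ℝ)⁻¹) := by
    have := congrArg (Rat.cast : ℚ → ℝ) (Nat.totient_eq_mul_prod_factors m)
    push_cast at this
    exact this
  have hpos : (m.totient : ℝ) ≠ 0 := by
    exact_mod_cast (Nat.totient_pos.2 (Nat.pos_of_ne_zero hm)).ne'
  apply mul_right_cancel₀ hpos
  rw [← Nat.card_coe_set_eq]
  refine h2.symm.trans ?_
  rw [h3]
  have h4 : (m : ℝ) ^ n = (m : ℝ) ^ (n - 1) * m := by
    rw [← pow_succ]; congr 1; omega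
  rw [h4]
  have h5 : ∏ p ∈ m.primeFactors, (1 - ((p : ℝ) ^ n)⁻¹) =
      (∏ p ∈ m.primeFactors, (1 + hfac n p)) * ∏ p ∈ m.primeFactors, (1 - (p : ℝ)⁻¹) := by
    rw [← Finset.prod_mul_distrib]
    refine Finset.prod_congr rfl fun p hp => ?_
    have hp2 : (2 : ℝ) ≤ p := by exact_mod_cast (Nat.prime_of_mem_primeFactors hp).two_le
    obtain ⟨k, rfl⟩ : ∃ k, n = k + 1 := ⟨n - 1, by omega⟩
    unfold hfac
    have h6 : (p : ℝ) ^ (k + 1) - (p : ℝ) ^ k ≠ 0 := by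
      have : (0 : ℝ) < (p : ℝ) ^ k * (p - 1) := by
        have : (0 : ℝ) < p - 1 := by linarith
        positivity
      rw [pow_succ]; nlinarith
    have h7 : (p : ℝ) ≠ 0 := by linarith
    have h8 : (p : ℝ) - 1 ≠ 0 := by intro h; linarith
    have h9 : (p : ℝ) ^ (k + 1) - (p : ℝ) ^ k = (p : ℝ) ^ k * (p - 1) := by ring
    simp only [Nat.add_sub_cancel]
    rw [h9]
    field_simp
    ring
  rw [h5]
  ring

lemma count_eq (n : ℕ) (hn : 2 ≤ n) (V : ℝ) (hV : 0 ≤ V) :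
    (cocyclicCount n V : ℝ) =
      ∑ m ∈ Finset.Icc 1 ⌊V⌋₊, (m : ℝ) ^ (n - 1) * ∏ p ∈ m.primeFactors, (1 + hfac n p) := by
  classical
  let A : ℕ → Set (AddSubgroup (Fin n → ℤ)) := fun m =>
    {L | L.index = m ∧ IsAddCyclic ((Fin n → ℤ) ⧸ L)}
  have h0 : {L : AddSubgroup (Fin n → ℤ) |
      L.index ≠ 0 ∧ (L.index : ℝ) ≤ V ∧ IsAddCyclic ((Fin n → ℤ) ⧸ L)} =
      ⋃ m ∈ ((Finset.Icc 1 ⌊V⌋₊ : Finset ℕ) : Set ℕ), A m := by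
    ext L
    simp only [Set.mem_iUnion, A, Set.mem_ofPred_eq, Finset.coe_Icc, Set.mem_Icc, exists_prop]
    constructor
    · rintro ⟨h1, h2, h3⟩
      exact ⟨L.index, ⟨Nat.one_le_iff_ne_zero.2 h1, Nat.le_floor h2⟩, rfl, h3⟩
    · rintro ⟨m, ⟨h1, h2⟩, rfl, h3⟩
      exact ⟨Nat.one_le_iff_ne_zero.1 h1, (Nat.le_floor_iff hV).1 h2, h3⟩
  have hfin : ∀ m ∈ Finset.Icc 1 ⌊V⌋₊, (A m).Finite := by
    intro m hm
    exact finite_L n m (Nat.one_le_iff_ne_zero.1 (Finset.mem_Icc.1 hm).1)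
  rw [cocyclicCount, h0]
  have h1 : (⋃ m ∈ ((Finset.Icc 1 ⌊V⌋₊ : Finset ℕ) : Set ℕ), A m).ncard =
      ∑ m ∈ Finset.Icc 1 ⌊V⌋₊, (A m).ncard := by
    rw [Set.ncard_eq_toFinset_card _ (Set.Finite.biUnion (Finset.finite_toSet _) hfin)]
    let B : ℕ → Finset (AddSubgroup (Fin n → ℤ)) := fun m =>
      if h : (A m).Finite then h.toFinset else ∅
    have hB : ∀ m ∈ Finset.Icc 1 ⌊V⌋₊, (A m).ncard = (B m).card := by
      intro m hm
      simp only [B, dif_pos (hfin m hm)]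
      exact Set.ncard_eq_toFinset_card _ _
    have hB' : ∀ m ∈ Finset.Icc 1 ⌊V⌋₊, ∀ L, L ∈ B m ↔ L ∈ A m := by
      intro m hm L
      simp only [B, dif_pos (hfin m hm), Set.Finite.mem_toFinset]
    rw [Finset.sum_congr rfl hB, ← Finset.card_biUnion]
    · congr 1
      ext L
      simp only [Set.Finite.mem_toFinset, Set.mem_iUnion, Finset.mem_biUnion, exists_prop,
        Finset.mem_coe]
      exact exists_congr fun m => and_congr_right fun hm => (hB' m hm L).symm
    · intro a ha b hb hab
      change Disjoint (B a) (B b)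
      rw [Finset.disjoint_left]
      intro L h1 h2
      exact hab (((hB' a ha L).1 h1).1.symm.trans ((hB' b hb L).1 h2).1)
  rw [h1, Nat.cast_sum]
  refine Finset.sum_congr rfl fun m hm => ?_
  exact card_L n m hn (Nat.one_le_iff_ne_zero.1 (Finset.mem_Icc.1 hm).1)

lemma pow_step (k : ℝ) (hk : 0 ≤ k) (n : ℕ) :
    k ^ (n + 1) + (n + 1) * k ^ n ≤ (k + 1) ^ (n + 1) ∧
    (k + 1) ^ (n + 1) ≤ k ^ (n + 1) + (n + 1) * (k + 1) ^ n := by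
  induction n with
  | zero => simp
  | succ n ih =>
    obtain ⟨h1, h2⟩ := ih
    have hp : 0 ≤ k ^ n := by positivity
    constructor
    · calc _ ≤ (k ^ (n + 1) + (n + 1) * k ^ n) * (k + 1) := by
            push_cast
            have : (0 : ℝ) ≤ (n + 1) * k ^ n := by positivity
            ring_nf at this ⊢
            linarith
        _ ≤ _ := by rw [pow_succ (k + 1)]; gcongr
    · have h3 : k ^ (n + 1) ≤ (k + 1) ^ (n + 1) := by gcongr; linarith
      calc (k + 1) ^ (n + 1 + 1) = (k + 1) ^ (n + 1) * k + (k + 1) ^ (n + 1) := by ring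
        _ ≤ (k ^ (n + 1) + (n + 1) * (k + 1) ^ n) * k + (k + 1) ^ (n + 1) := by gcongr
        _ ≤ _ := by
            push_cast
            have : 0 ≤ (n + 1) * (k + 1) ^ n := by positivity
            ring_nf at this ⊢
            linarith

/-- power sums -/
noncomputable def psum (n N : ℕ) : ℝ := ∑ k ∈ Finset.Icc 1 N, (k : ℝ) ^ n

lemma psum_bounds (n N : ℕ) :
    (N : ℝ) ^ (n + 1) ≤ (n + 1) * psum n N ∧ (n + 1) * psum n N ≤ ((N : ℝ) + 1) ^ (n + 1) := by
  induction N with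
  | zero => simp [psum]
  | succ N ih =>
    have e : psum n (N + 1) = psum n N + ((N : ℝ) + 1) ^ n := by
      simp [psum, Finset.sum_Icc_succ_top]
    obtain ⟨h1, h2⟩ := ih
    have h3 := (pow_step N (by positivity) n).2
    have h4 := (pow_step (N + 1) (by positivity) n).1
    rw [e]
    push_cast
    constructor <;> nlinarith

lemma psum_le (n N : ℕ) : psum n N ≤ (N : ℝ) ^ (n + 1) := by
  unfold psum
  calc _ ≤ ∑ k ∈ Finset.Icc 1 N, (N : ℝ) ^ n := by
        refine Finset.sum_le_sum fun k hk => ?_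
        have := (Finset.mem_Icc.1 hk).2
        gcongr
    _ = _ := by simp; ring

lemma psum_tendsto (n : ℕ) :
    Tendsto (fun x : ℝ => (n + 1) * psum n ⌊x⌋₊ / x ^ (n + 1)) atTop (nhds 1) := by
  have h1 : Tendsto (fun x : ℝ => ((⌊x⌋₊ : ℝ) / x) ^ (n + 1)) atTop (nhds 1) := by
    simpa using (tendsto_nat_floor_div_atTop (R := ℝ)).pow (n + 1)
  have h2 : Tendsto (fun x : ℝ => ((⌊x⌋₊ : ℝ) / x + x⁻¹) ^ (n + 1)) atTop (nhds 1) := by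
    simpa using ((tendsto_nat_floor_div_atTop (R := ℝ)).add tendsto_inv_atTop_zero).pow (n + 1)
  refine tendsto_of_tendsto_of_tendsto_of_le_of_le' h1 h2 ?_ ?_
  · filter_upwards [eventually_gt_atTop 0] with x hx
    rw [div_pow]
    have := (psum_bounds n ⌊x⌋₊).1
    gcongr
  · filter_upwards [eventually_gt_atTop 0] with x hx
    have := (psum_bounds n ⌊x⌋₊).2
    have e : (⌊x⌋₊ : ℝ) / x + x⁻¹ = (⌊x⌋₊ + 1) / x := by field_simp
    rw [e, div_pow]
    gcongr

/-- prime factors as a finset of `Nat.Primes` -/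
def primeSet (m : ℕ) : Finset Nat.Primes := m.primeFactors.subtype Nat.Prime

lemma mem_primeSet (m : ℕ) (p : Nat.Primes) : p ∈ primeSet m ↔ (p : ℕ) ∈ m.primeFactors :=
  Finset.mem_subtype

lemma prod_primeSet {M : Type*} [CommMonoid M] (m : ℕ) (f : ℕ → M) :
    ∏ p ∈ primeSet m, f (p : ℕ) = ∏ p ∈ m.primeFactors, f p :=
  Finset.prod_subtype_of_mem (p := Nat.Prime) f (fun _ hp => Nat.prime_of_mem_primeFactors hp)

lemma dvd_iff (m : ℕ) (hm : m ≠ 0) (S : Finset Nat.Primes) :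
    (∏ p ∈ S, (p : ℕ)) ∣ m ↔ S ∈ (primeSet m).powerset := by
  rw [Finset.mem_powerset]
  constructor
  · intro h p hp
    rw [mem_primeSet]
    exact Nat.mem_primeFactors.2
      ⟨p.2, (Finset.dvd_prod_of_mem (fun p : Nat.Primes => (p : ℕ)) hp).trans h, hm⟩
  · intro h
    have h1 := Finset.prod_dvd_prod_of_subset _ _ (fun p : Nat.Primes => (p : ℕ)) h
    refine h1.trans ?_
    rw [prod_primeSet m (fun p => p)]
    exact Nat.prod_primeFactors_dvd m

lemma sum_dvd (n N d : ℕ) (hd : 0 < d) :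
    ∑ m ∈ Finset.Icc 1 N, (if d ∣ m then (m : ℝ) ^ n else 0) = (d : ℝ) ^ n * psum n (N / d) := by
  rw [← Finset.sum_filter, psum, Finset.mul_sum]
  symm
  refine Finset.sum_nbij' (fun k => d * k) (fun m => m / d) ?_ ?_ ?_ ?_ ?_
  · intro k hk
    rw [Finset.mem_Icc, Nat.le_div_iff_mul_le hd] at hk
    rw [Finset.mem_filter, Finset.mem_Icc]
    exact ⟨⟨Nat.mul_pos hd hk.1, by linarith [mul_comm k d]⟩, dvd_mul_right _ _⟩
  · intro m hm
    rw [Finset.mem_filter, Finset.mem_Icc] at hm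
    rw [Finset.mem_Icc]
    exact ⟨Nat.div_pos (Nat.le_of_dvd hm.1.1 hm.2) hd, Nat.div_le_div_right hm.1.2⟩
  · intro k _
    exact Nat.mul_div_cancel_left _ hd
  · intro m hm
    exact Nat.mul_div_cancel' (Finset.mem_filter.1 hm).2
  · intro k _
    push_cast
    ring

lemma count_tsum (n N : ℕ) :
    ∑ m ∈ Finset.Icc 1 N, (m : ℝ) ^ (n - 1) * ∏ p ∈ m.primeFactors, (1 + hfac n p) =
    ∑' S : Finset Nat.Primes, (∏ p ∈ S, hfac n p) *
      (((∏ p ∈ S, (p : ℕ) : ℕ) : ℝ) ^ (n - 1) * psum (n - 1) (N / ∏ p ∈ S, (p : ℕ))) := by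
  classical
  have h1 : ∀ m ∈ Finset.Icc 1 N, HasSum (fun S : Finset Nat.Primes =>
      (∏ p ∈ S, hfac n p) * (if (∏ p ∈ S, (p : ℕ)) ∣ m then (m : ℝ) ^ (n - 1) else 0))
      ((m : ℝ) ^ (n - 1) * ∏ p ∈ m.primeFactors, (1 + hfac n p)) := by
    intro m hm
    have hm0 : m ≠ 0 := Nat.one_le_iff_ne_zero.1 (Finset.mem_Icc.1 hm).1
    have e2 : (m : ℝ) ^ (n - 1) * ∏ p ∈ m.primeFactors, (1 + hfac n p) =
        ∑ S ∈ (primeSet m).powerset, (∏ p ∈ S, hfac n (p : ℕ)) *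
          (if (∏ p ∈ S, (p : ℕ)) ∣ m then (m : ℝ) ^ (n - 1) else 0) := by
      rw [← prod_primeSet m (fun p => 1 + hfac n p), Finset.prod_one_add, Finset.mul_sum]
      refine Finset.sum_congr rfl fun S hS => ?_
      rw [if_pos ((dvd_iff m hm0 S).2 hS), mul_comm]
    rw [e2]
    refine hasSum_sum_of_ne_finset_zero fun S hS => ?_
    rw [if_neg (fun h => hS ((dvd_iff m hm0 S).1 h)), mul_zero]
  have h2 := hasSum_sum h1
  rw [← h2.tsum_eq]
  refine tsum_congr fun S => ?_
  rw [← Finset.mul_sum, sum_dvd]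
  exact Finset.prod_pos fun p _ => p.2.pos

lemma hfac_bound (n p : ℕ) (hn : 2 ≤ n) (hp : 2 ≤ p) :
    0 ≤ hfac n p / p ∧ hfac n p / p ≤ 2 * (1 / (p : ℝ) ^ 2) := by
  obtain ⟨k, rfl⟩ : ∃ k, n = k + 1 := ⟨n - 1, by omega⟩
  have hp2 : (2 : ℝ) ≤ p := by exact_mod_cast hp
  have h9 : (p : ℝ) ^ (k + 1) - (p : ℝ) ^ k = (p : ℝ) ^ k * (p - 1) := by ring
  have h1 : (1 : ℝ) ≤ (p : ℝ) ^ k := one_le_pow₀ (by linarith)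
  have h2 : (0 : ℝ) < (p : ℝ) - 1 := by linarith
  unfold hfac
  simp only [Nat.add_sub_cancel]
  rw [h9]
  constructor
  · have : 0 ≤ (p : ℝ) ^ k - 1 := by linarith
    positivity
  · rw [div_div, mul_one_div, div_le_div_iff₀ (by positivity) (by positivity)]
    have h3 : ((p : ℝ) ^ k - 1) * (p : ℝ) ^ 2 ≤ (p : ℝ) ^ k * (p : ℝ) ^ 2 := by gcongr; linarith
    have h4 : (p : ℝ) ^ k * ((p : ℝ) * p) ≤ (p : ℝ) ^ k * (2 * (p - 1) * p) := by
      gcongr; linarith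
    nlinarith

lemma theta_eq (n : ℕ) (hn : 2 ≤ n) :
    thetaN n = ∏' p : Nat.Primes, (1 + hfac n p / (p : ℕ)) := by
  unfold thetaN
  refine tprod_congr fun p => ?_
  obtain ⟨k, rfl⟩ : ∃ k, n = k + 1 := ⟨n - 1, by omega⟩
  unfold hfac
  simp only [Nat.add_sub_cancel]
  rw [div_div]
  congr 2
  ring

lemma summable_main (n : ℕ) (hn : 2 ≤ n) :
    Summable (fun S : Finset Nat.Primes => ∏ p ∈ S, (hfac n p / (p : ℕ))) := by
  refine summable_finsetProd_of_summable_nonneg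
    (f := fun p : Nat.Primes => hfac n p / (p : ℕ)) (fun p => (hfac_bound n p hn p.2.two_le).1) ?_
  refine Summable.of_nonneg_of_le (fun p => (hfac_bound n p hn p.2.two_le).1)
    (fun p => (hfac_bound n p hn p.2.two_le).2) ?_
  have : Summable (fun k : ℕ => 2 * (1 / (k : ℝ) ^ 2)) :=
    (Real.summable_one_div_nat_pow.2 one_lt_two).mul_left 2
  exact this.comp_injective (i := fun p : Nat.Primes => (p : ℕ)) Subtype.coe_injective

theorem cocyclic_asymptotic (n : ℕ) (hn : 2 ≤ n) :
    Tendsto (fun V : ℝ => (cocyclicCount n V : ℝ) * n / V ^ n) atTop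
      (nhds (thetaN n)) := by
  have hsum := summable_main n hn
  rw [theta_eq n hn, tprod_one_add hsum]
  let D : Finset Nat.Primes → ℕ := fun S => ∏ p ∈ S, (p : ℕ)
  have hD : ∀ S, 0 < D S := fun S => Finset.prod_pos fun p _ => p.2.pos
  let c : Finset Nat.Primes → ℝ := fun S => ∏ p ∈ S, (hfac n p / (p : ℕ))
  have hc : ∀ S, 0 ≤ c S := fun S =>
    Finset.prod_nonneg fun p _ => (hfac_bound n p hn p.2.two_le).1
  obtain ⟨k, rfl⟩ : ∃ k, n = k + 1 := ⟨n - 1, by omega⟩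
  let F : ℝ → Finset Nat.Primes → ℝ := fun V S =>
    c S * ((k + 1) * psum k ⌊V / D S⌋₊ / (V / D S) ^ (k + 1))
  have key : Tendsto (fun V => ∑' S, F V S) atTop (nhds (∑' S, c S)) := by
    refine tendsto_tsum_of_dominated_convergence (bound := fun S => c S * (k + 1))
      (hsum.mul_right _) ?_ ?_
    · intro S
      have hd : (0 : ℝ) < D S := by exact_mod_cast hD S
      have := (psum_tendsto k).comp (tendsto_id.atTop_div_const hd)
      simpa [F] using this.const_mul (c S)
    · filter_upwards [eventually_gt_atTop 0] with V hV S
      have hd : (0 : ℝ) < D S := by exact_mod_cast hD S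
      have hx : 0 < V / D S := by positivity
      have h0 : 0 ≤ psum k ⌊V / D S⌋₊ := Finset.sum_nonneg fun _ _ => by positivity
      have h1 : psum k ⌊V / D S⌋₊ ≤ (V / D S) ^ (k + 1) := by
        refine (psum_le _ _).trans ?_
        have := Nat.floor_le hx.le
        gcongr
      have h2 := hc S
      rw [Real.norm_of_nonneg (by positivity)]
      refine mul_le_mul_of_nonneg_left ?_ h2
      rw [div_le_iff₀ (by positivity)]
      gcongr
  refine key.congr' ?_
  filter_upwards [eventually_gt_atTop 0] with V hV
  rw [count_eq _ hn V hV.le, count_tsum, mul_div_assoc, ← tsum_mul_right]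
  refine tsum_congr fun S => ?_
  have hd : (0 : ℝ) < D S := by exact_mod_cast hD S
  simp only [F, c, Nat.add_sub_cancel]
  rw [Finset.prod_div_distrib, ← Nat.cast_prod]
  change _ / ((D S : ℕ) : ℝ) * _ = _ * (((D S : ℕ) : ℝ) ^ k * psum k (⌊V⌋₊ / D S)) * _
  rw [Nat.floor_div_natCast]
  push_cast
  rw [div_pow]
  field_simp
  ring
end

section
/- For any fixed integer n ≥ 2, as V → ∞ one has N♯_n(V) = ((ρ_n + o(1))/n)·V^n; that is, the limit of N♯_n(V)·n/V^n as V → ∞ equals ρ_n. -/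
open Filter

/-- `ρ_n = (6/π²) · ∏_p (1 + (p^(n-1) - 1)/(p^(n+1) - p^(n-1)))`. -/
noncomputable def rhoN (n : ℕ) : ℝ :=
  6 / Real.pi ^ 2 *
    ∏' p : Nat.Primes, (1 + ((p : ℝ) ^ (n - 1) - 1) / ((p : ℝ) ^ (n + 1) - (p : ℝ) ^ (n - 1)))

/-- `N♯_n(V)`: the number of subgroups `L ⊆ ℤ^n` whose index is squarefree and at most `V`. -/
noncomputable def squarefreeIndexCount (n : ℕ) (V : ℝ) : ℕ :=
  Set.ncard {L : AddSubgroup (Fin n → ℤ) | Squarefree L.index ∧ (L.index : ℝ) ≤ V}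


lemma addCyclic_of_squarefree {A : Type*} [AddCommGroup A] [Finite A]
    (h : Squarefree (Nat.card A)) : IsAddCyclic A := by
  rw [IsAddCyclic.iff_exponent_eq_card]
  apply Nat.dvd_antisymm
  · exact AddGroup.exponent_dvd_nat_card
  · rw [← Nat.prod_primeFactors_of_squarefree h]
    apply Finset.prod_primes_dvd
    · intro p hp
      exact (Nat.prime_of_mem_primeFactors hp).prime
    · intro p hp
      have : Fact p.Prime := ⟨Nat.prime_of_mem_primeFactors hp⟩
      obtain ⟨x, hx⟩ := exists_prime_addOrderOf_dvd_card' p (Nat.dvd_of_mem_primeFactors hp)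
      rw [← hx]
      exact AddMonoid.addOrder_dvd_exponent x

instance finite_homs (n m : ℕ) [NeZero m] : Finite ((Fin n → ℤ) →+ ZMod m) := by
  have e : (Fin n → ZMod m) ≃ ((Fin n → ℤ) →ₗ[ℤ] ZMod m) :=
    ((Pi.basisFun ℤ (Fin n)).constr ℤ).toEquiv
  have e2 : (Fin n → ZMod m) ≃ ((Fin n → ℤ) →+ ZMod m) :=
    e.trans (addMonoidHomLequivInt ℤ).symm.toEquiv
  exact Finite.of_equiv _ e2

lemma card_homs (n m : ℕ) [NeZero m] : Nat.card ((Fin n → ℤ) →+ ZMod m) = m ^ n := by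
  have e : (Fin n → ZMod m) ≃ ((Fin n → ℤ) →ₗ[ℤ] ZMod m) :=
    ((Pi.basisFun ℤ (Fin n)).constr ℤ).toEquiv
  have e2 : (Fin n → ZMod m) ≃ ((Fin n → ℤ) →+ ZMod m) :=
    e.trans (addMonoidHomLequivInt ℤ).symm.toEquiv
  rw [← Nat.card_congr e2]
  simp

lemma card_fiber {G : Type*} [AddCommGroup G] (m d : ℕ) [NeZero m] (hd : d ∣ m)
    (hsq : Squarefree m) (L : AddSubgroup G) (hL : L.index = d) :
    Nat.card {f : G →+ ZMod m // f.ker = L} = d.totient := by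
  classical
  have hd0 : d ≠ 0 := by rintro rfl; exact NeZero.ne m (by simpa using hd)
  have hcard : Nat.card (G ⧸ L) = d := hL
  have : Finite (G ⧸ L) := Nat.finite_of_card_ne_zero (by rw [hcard]; exact hd0)
  have hc : IsAddCyclic (G ⧸ L) := addCyclic_of_squarefree (by
    rw [hcard]; exact hsq.squarefree_of_dvd hd)
  have e : ZMod d ≃+ (G ⧸ L) := by
    have := zmodAddCyclicAddEquiv hc
    rwa [hcard] at this
  let π : G →+ ZMod d := e.symm.toAddMonoidHom.comp (QuotientAddGroup.mk' L)
  have hπ : π.ker = L := by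
    ext x; simp [π, AddMonoidHom.mem_ker]
  have hπs : Function.Surjective π := 
    e.symm.surjective.comp (QuotientAddGroup.mk'_surjective L)
  obtain ⟨x, hx⟩ := hπs 1
  have hker : ∀ y, y ∈ L ↔ π y = 0 := fun y => by rw [← hπ]; rfl
  have hdec : ∀ y : G, ∃ k : ℤ, y - k • x ∈ L := by
    intro y
    obtain ⟨k, hk⟩ := ZMod.intCast_surjective (π y)
    refine ⟨k, ?_⟩
    rw [hker, map_sub, map_zsmul, hx, ← hk]; simp
  have hdx : d • x ∈ L := by rw [hker, map_nsmul, hx]; simp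
  have hmulx : ∀ k : ℤ, k • x ∈ L ↔ (d : ℤ) ∣ k := by
    intro k
    rw [hker, map_zsmul, hx, zsmul_one, ZMod.intCast_zmod_eq_zero_iff_dvd _ d]
  have htot : Nat.card {y : ZMod m // addOrderOf y = d} = d.totient := by
    rw [← IsAddCyclic.card_addOrderOf_eq_totient (α := ZMod m) (d := d) (by simpa using hd)]
    rw [Nat.card_eq_fintype_card, Fintype.card_subtype]
  rw [← htot]
  have hord : ∀ f : G →+ ZMod m, f.ker = L → addOrderOf (f x) = d := by
    intro f hf
    apply Nat.dvd_antisymm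
    · rw [addOrderOf_dvd_iff_nsmul_eq_zero, ← map_nsmul, ← AddMonoidHom.mem_ker, hf]
      exact hdx
    · have h1 : (addOrderOf (f x) : ℤ) • x ∈ L := by
        rw [← hf, AddMonoidHom.mem_ker, map_zsmul, natCast_zsmul, addOrderOf_nsmul_eq_zero]
      exact_mod_cast (hmulx _).1 h1
  apply Nat.card_congr
  refine Equiv.ofBijective (fun f => ⟨f.1 x, hord f.1 f.2⟩) ⟨?_, ?_⟩
  · rintro ⟨f, hf⟩ ⟨g, hg⟩ h
    simp only [Subtype.mk.injEq] at h ⊢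
    ext y
    obtain ⟨k, hk⟩ := hdec y
    have h1 : f (y - k • x) = 0 := by rw [← AddMonoidHom.mem_ker, hf]; exact hk
    have h2 : g (y - k • x) = 0 := by rw [← AddMonoidHom.mem_ker, hg]; exact hk
    rw [map_sub, map_zsmul, sub_eq_zero] at h1 h2
    rw [h1, h2, h]
  · rintro ⟨y, hy⟩
    let φ : {f : ℤ →+ ZMod m // f d = 0} := ⟨zmultiplesHom _ y, by
      simp only [zmultiplesHom_apply, natCast_zsmul]
      rw [← hy, addOrderOf_nsmul_eq_zero]⟩
    have hinj : Function.Injective (ZMod.lift d φ) := by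
      rw [ZMod.lift_injective]
      intro k hk
      simp only [φ, zmultiplesHom_apply] at hk
      rw [ZMod.intCast_zmod_eq_zero_iff_dvd _ d, ← hy]
      exact addOrderOf_dvd_iff_zsmul_eq_zero.2 hk
    refine ⟨⟨(ZMod.lift d φ).comp π, ?_⟩, ?_⟩
    · ext z
      rw [AddMonoidHom.mem_ker, hker]
      simp only [AddMonoidHom.comp_apply]
      exact map_eq_zero_iff _ hinj
    · simp only [AddMonoidHom.comp_apply, hx, Subtype.mk.injEq]
      have := ZMod.lift_coe d φ 1
      simpa [φ] using this

lemma exists_hom_ker {G : Type*} [AddCommGroup G] (m : ℕ) (hsq : Squarefree m)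
    (L : AddSubgroup G) (hL : L.index ∣ m) : ∃ f : G →+ ZMod m, f.ker = L := by
  have : NeZero m := ⟨hsq.ne_zero⟩
  have h := card_fiber m L.index hL hsq L rfl
  have : 0 < Nat.card {f : G →+ ZMod m // f.ker = L} := by
    rw [h]; exact Nat.totient_pos.2 (Nat.pos_of_dvd_of_pos hL (NeZero.pos m))
  obtain ⟨⟨f, hf⟩⟩ := (Nat.card_pos_iff.1 this).1
  exact ⟨f, hf⟩

lemma finite_index_dvd (n m : ℕ) (hsq : Squarefree m) :
    {L : AddSubgroup (Fin n → ℤ) | L.index ∣ m}.Finite := by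
  have : NeZero m := ⟨hsq.ne_zero⟩
  refine (Set.finite_range (fun f : (Fin n → ℤ) →+ ZMod m => f.ker)).subset ?_
  intro L hL
  exact exists_hom_ker m hsq L hL

noncomputable def idxCount (n m : ℕ) : ℕ := Set.ncard {L : AddSubgroup (Fin n → ℤ) | L.index = m}

lemma sum_totient_idxCount (n m : ℕ) (hsq : Squarefree m) :
    ∑ d ∈ m.divisors, d.totient * idxCount n d = m ^ n := by
  classical
  have : NeZero m := ⟨hsq.ne_zero⟩
  have := Fintype.ofFinite ((Fin n → ℤ) →+ ZMod m)
  let T := (finite_index_dvd n m hsq).toFinset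
  have hmaps : Set.MapsTo (fun f : (Fin n → ℤ) →+ ZMod m => f.ker)
      ((Finset.univ : Finset ((Fin n → ℤ) →+ ZMod m)) : Set _) (T : Set _) := by
    intro f _
    simp only [T, Set.Finite.coe_toFinset, Set.mem_ofPred_eq, AddSubgroup.index_ker]
    have := AddSubgroup.card_addSubgroup_dvd_card f.range
    simpa using this
  have h1 := Finset.card_eq_sum_card_fiberwise hmaps
  rw [Finset.card_univ, ← Nat.card_eq_fintype_card, card_homs] at h1
  rw [h1]
  have hT : ∀ L ∈ T, L.index ∈ m.divisors := by
    intro L hL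
    simp only [T, Set.Finite.mem_toFinset, Set.mem_ofPred_eq] at hL
    simp [hL, NeZero.ne m]
  rw [← Finset.sum_fiberwise_of_maps_to hT]
  refine Finset.sum_congr rfl fun d hd => ?_
  have hdm := Nat.dvd_of_mem_divisors hd
  have h2 : ∀ L ∈ T.filter (fun L => L.index = d),
      (Finset.univ.filter (fun f : (Fin n → ℤ) →+ ZMod m => f.ker = L)).card = d.totient := by
    intro L hL
    rw [← card_fiber m d hdm hsq L (Finset.mem_filter.1 hL).2, Nat.card_eq_fintype_card,
      Fintype.card_subtype]
  rw [Finset.sum_congr rfl h2, Finset.sum_const, smul_eq_mul, mul_comm]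
  congr 1
  rw [idxCount, ← Set.ncard_coe_finset]
  congr 1
  ext L
  simp only [Set.mem_ofPred_eq, Finset.coe_filter, T, Set.Finite.mem_toFinset]
  constructor
  · rintro rfl; exact ⟨hdm, rfl⟩
  · exact fun h => h.2

lemma totient_mul_idxCount (n m : ℕ) (hsq : Squarefree m) :
    ((m.totient * idxCount n m : ℕ) : ℝ) = ∏ p ∈ m.primeFactors, ((p : ℝ) ^ n - 1) := by
  induction m using Nat.strong_induction_on with
  | _ m ih =>
  have h1 : ((∑ d ∈ m.divisors, d.totient * idxCount n d : ℕ) : ℝ) = (m : ℝ) ^ n := by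
    rw [sum_totient_idxCount n m hsq]; push_cast; rfl
  have hm := ArithmeticFunction.IsMultiplicative.prodPrimeFactors (fun p : ℕ => (p : ℝ) ^ n - 1)
  have h2 := hm.prodPrimeFactors_one_add_of_squarefree hsq
  have h3 : ∏ p ∈ m.primeFactors, (1 + ArithmeticFunction.prodPrimeFactors (fun p : ℕ => (p : ℝ) ^ n - 1) p) = (m : ℝ) ^ n := by
    conv_rhs => rw [← Nat.prod_primeFactors_of_squarefree hsq]
    push_cast
    rw [← Finset.prod_pow]
    refine Finset.prod_congr rfl fun p hp => ?_
    have hp := Nat.prime_of_mem_primeFactors hp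
    rw [ArithmeticFunction.prodPrimeFactors_apply hp.ne_zero, hp.primeFactors]
    simp
  rw [h3, ← h1] at h2
  push_cast at h2
  rw [← Nat.cons_self_properDivisors hsq.ne_zero, Finset.sum_cons, Finset.sum_cons] at h2
  have h4 : ∀ d ∈ m.properDivisors, (d.totient : ℝ) * idxCount n d =
      ArithmeticFunction.prodPrimeFactors (fun p : ℕ => (p : ℝ) ^ n - 1) d := by
    intro d hd
    rw [Nat.mem_properDivisors] at hd
    have hs := hsq.squarefree_of_dvd hd.1
    have := ih d hd.2 hs
    push_cast at this
    rw [this, ArithmeticFunction.prodPrimeFactors_apply hs.ne_zero]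
  rw [Finset.sum_congr rfl h4] at h2
  push_cast
  rw [add_right_cancel h2, ArithmeticFunction.prodPrimeFactors_apply hsq.ne_zero]

lemma totient_squarefree (m : ℕ) (hsq : Squarefree m) :
    (m.totient : ℝ) = ∏ p ∈ m.primeFactors, ((p : ℝ) - 1) := by
  have h := Nat.totient_mul_prod_primeFactors m
  have h2 : (m.totient * ∏ p ∈ m.primeFactors, p : ℕ) = m.totient * m := by
    rw [Nat.prod_primeFactors_of_squarefree hsq]
  rw [h2, mul_comm] at h
  have h3 := Nat.eq_of_mul_eq_mul_left (Nat.pos_of_ne_zero hsq.ne_zero) h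
  rw [h3]; push_cast
  refine Finset.prod_congr rfl fun p hp => ?_
  rw [Nat.cast_sub (Nat.prime_of_mem_primeFactors hp).one_le]; simp

lemma idxCount_eq (n m : ℕ) (hsq : Squarefree m) :
    (idxCount n m : ℝ) = ∏ p ∈ m.primeFactors, ∑ i ∈ Finset.range n, (p : ℝ) ^ i := by
  have h := totient_mul_idxCount n m hsq
  push_cast at h
  have h0 : (m.totient : ℝ) ≠ 0 := by
    have := Nat.totient_pos.2 (Nat.pos_of_ne_zero hsq.ne_zero)
    positivity
  apply mul_left_cancel₀ h0
  rw [h, totient_squarefree m hsq, ← Finset.prod_mul_distrib]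
  refine Finset.prod_congr rfl fun p hp => ?_
  rw [mul_comm, geom_sum_mul]

lemma finite_index_eq (n m : ℕ) (hsq : Squarefree m) :
    {L : AddSubgroup (Fin n → ℤ) | L.index = m}.Finite :=
  (finite_index_dvd n m hsq).subset fun L hL => by simp only [Set.mem_ofPred_eq] at *; simp [hL]

lemma count_eq_s2 (n : ℕ) (V : ℝ) (hV : 0 ≤ V) :
    Set.ncard {L : AddSubgroup (Fin n → ℤ) | Squarefree L.index ∧ (L.index : ℝ) ≤ V} =
      ∑ m ∈ Finset.Ioc 0 ⌊V⌋₊, if Squarefree m then idxCount n m else 0 := by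
  classical
  rw [← Finset.sum_filter]
  have hS : {L : AddSubgroup (Fin n → ℤ) | Squarefree L.index ∧ (L.index : ℝ) ≤ V} =
      ⋃ m ∈ (Finset.Ioc 0 ⌊V⌋₊).filter Squarefree,
        {L : AddSubgroup (Fin n → ℤ) | L.index = m} := by
    ext L
    simp only [Set.mem_ofPred_eq, Set.mem_iUnion, Finset.mem_filter, Finset.mem_Ioc,
      exists_prop, exists_eq_right', Nat.le_floor_iff hV]
    constructor
    · rintro ⟨h1, h2⟩; exact ⟨⟨Nat.pos_of_ne_zero h1.ne_zero, h2⟩, h1⟩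
    · rintro ⟨⟨_, h2⟩, h1⟩; exact ⟨h1, h2⟩
  have hfin : {L : AddSubgroup (Fin n → ℤ) | Squarefree L.index ∧ (L.index : ℝ) ≤ V}.Finite := by
    rw [hS]
    exact Set.Finite.biUnion (Finset.finite_toSet _) fun m hm => 
      finite_index_eq n m (Finset.mem_filter.1 hm).2
  rw [Set.ncard_eq_toFinset_card _ hfin]
  have hmaps : ∀ L ∈ hfin.toFinset, L.index ∈ (Finset.Ioc 0 ⌊V⌋₊).filter Squarefree := by
    intro L hL
    rw [Set.Finite.mem_toFinset] at hL
    simp only [Finset.mem_filter, Finset.mem_Ioc, Nat.le_floor_iff hV]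
    exact ⟨⟨Nat.pos_of_ne_zero hL.1.ne_zero, hL.2⟩, hL.1⟩
  rw [Finset.card_eq_sum_card_fiberwise hmaps]
  refine Finset.sum_congr rfl fun m hm => ?_
  rw [idxCount, ← Set.ncard_coe_finset]
  congr 1
  ext L
  simp only [Finset.mem_filter, Finset.mem_Ioc, Nat.le_floor_iff hV] at hm
  simp only [Finset.coe_filter, Set.Finite.mem_toFinset, Set.mem_ofPred_eq]
  constructor
  · exact fun h => h.2
  · rintro rfl; exact ⟨⟨hm.2, hm.1.2⟩, rfl⟩

noncomputable def hloc (n p : ℕ) : ℝ := ∑ i ∈ Finset.range n, ((p : ℝ)⁻¹) ^ i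

open scoped Classical in
noncomputable def Hfun (n : ℕ) : ArithmeticFunction ℝ :=
  ⟨fun m => if Squarefree m then ∏ p ∈ m.primeFactors, hloc n p else 0, by simp⟩

lemma Hfun_mult (n : ℕ) : (Hfun n).IsMultiplicative := by
  constructor
  · simp [Hfun]
  · intro a b hab
    simp only [Hfun, ArithmeticFunction.coe_mk, Nat.squarefree_mul hab]
    by_cases ha : Squarefree a <;> by_cases hb : Squarefree b <;> simp [ha, hb]
    rw [hab.primeFactors_mul, Finset.prod_union hab.disjoint_primeFactors]

noncomputable def kfun (n : ℕ) : ArithmeticFunction ℝ :=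
  (ArithmeticFunction.moebius : ArithmeticFunction ℝ) * Hfun n

lemma kfun_mult (n : ℕ) : (kfun n).IsMultiplicative :=
  ArithmeticFunction.isMultiplicative_moebius.intCast.mul (Hfun_mult n)

lemma sum_kfun (n m : ℕ) : ∑ d ∈ m.divisors, kfun n d = Hfun n m := by
  rw [← ArithmeticFunction.coe_zeta_mul_apply, kfun, ← mul_assoc,
    ArithmeticFunction.coe_zeta_mul_coe_moebius, one_mul]

lemma kfun_pow_succ (n p e : ℕ) (hp : p.Prime) :
    kfun n (p ^ (e + 1)) = Hfun n (p ^ (e + 1)) - Hfun n (p ^ e) := by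
  rw [← sum_kfun, ← sum_kfun, Nat.sum_divisors_prime_pow hp, Nat.sum_divisors_prime_pow hp,
    Finset.sum_range_succ _ (e + 1)]
  ring

lemma Hfun_prime (n p : ℕ) (hp : p.Prime) : Hfun n p = hloc n p := by
  simp [Hfun, hp.squarefree, hp.primeFactors]

lemma Hfun_pow (n p e : ℕ) (hp : p.Prime) : Hfun n (p ^ (e + 2)) = 0 := by
  have : ¬ Squarefree (p ^ (e + 2)) := by
    intro h
    have := h p ⟨p ^ e, by ring⟩
    exact hp.not_isUnit this
  simp [Hfun, this]

lemma kfun_p (n p : ℕ) (hp : p.Prime) : kfun n p = hloc n p - 1 := by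
  have := kfun_pow_succ n p 0 hp
  simpa [Hfun_prime n p hp, (Hfun_mult n).1] using this

lemma kfun_p2 (n p : ℕ) (hp : p.Prime) : kfun n (p ^ 2) = - hloc n p := by
  have := kfun_pow_succ n p 1 hp
  simpa [Hfun_prime n p hp, Hfun_pow n p 0 hp] using this

lemma kfun_p3 (n p e : ℕ) (hp : p.Prime) : kfun n (p ^ (e + 3)) = 0 := by
  rw [kfun_pow_succ n p (e + 2) hp, Hfun_pow n p e hp, Hfun_pow n p (e + 1) hp, sub_zero]

noncomputable def gfun (n d : ℕ) : ℝ := kfun n d / d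

lemma gfun_zero (n : ℕ) : gfun n 0 = 0 := by simp [gfun]
lemma gfun_one (n : ℕ) : gfun n 1 = 1 := by simp [gfun, (kfun_mult n).1]
lemma gfun_mul (n : ℕ) {a b : ℕ} (h : a.Coprime b) : gfun n (a * b) = gfun n a * gfun n b := by
  simp only [gfun, (kfun_mult n).2 h]; push_cast
  rw [mul_div_mul_comm]

lemma gfun_pow_zero (n p : ℕ) (hp : p.Prime) (e : ℕ) (he : e ∉ Finset.range 3) :
    gfun n (p ^ e) = 0 := by
  simp only [Finset.mem_range, not_lt] at he
  obtain ⟨e, rfl⟩ := Nat.exists_eq_add_of_le' he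
  simp [gfun, kfun_p3 n p e hp]

lemma hloc_nonneg (n p : ℕ) : 0 ≤ hloc n p := by
  unfold hloc; positivity

lemma hloc_le (n p : ℕ) (hp : p.Prime) : hloc n p ≤ n := by
  unfold hloc
  have h1 : ((p : ℝ)⁻¹) ≤ 1 := by
    apply inv_le_one_of_one_le₀; exact_mod_cast hp.one_le
  calc _ ≤ ∑ i ∈ Finset.range n, (1 : ℝ) :=
        Finset.sum_le_sum fun i _ => pow_le_one₀ (by positivity) h1
    _ = n := by simp

lemma hloc_sub_one (n p : ℕ) (hn : 2 ≤ n) (hp : p.Prime) :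
    |hloc n p - 1| ≤ n * (p : ℝ)⁻¹ := by
  obtain ⟨k, rfl⟩ : ∃ k, n = k + 1 := ⟨n - 1, by omega⟩
  have h : hloc (k + 1) p - 1 = (p : ℝ)⁻¹ * hloc k p := by
    unfold hloc
    rw [Finset.sum_range_succ', Finset.mul_sum]
    simp [pow_succ, mul_comm]
  rw [h, abs_of_nonneg (mul_nonneg (by positivity) (hloc_nonneg k p)), mul_comm]
  apply mul_le_mul_of_nonneg_right _ (by positivity)
  refine (hloc_le k p hp).trans ?_
  push_cast; linarith

lemma tsum_gfun_pow (n p : ℕ) (hp : p.Prime) (hn : 2 ≤ n) :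
    ∑' e, gfun n (p ^ e) = 1 - ((p : ℝ)⁻¹) ^ (n + 1) := by
  rw [tsum_eq_sum (s := Finset.range 3) (gfun_pow_zero n p hp)]
  have hp0 : (p : ℝ) ≠ 0 := by exact_mod_cast hp.ne_zero
  simp only [Finset.sum_range_succ, Finset.sum_range_zero, pow_zero, gfun_one, pow_one]
  simp only [gfun, kfun_p n p hp, kfun_p2 n p hp]
  push_cast
  have h := geom_sum_mul ((p : ℝ)⁻¹) n
  change hloc n p * _ = _ at h
  rw [pow_succ ((p : ℝ)⁻¹) n]
  have h' : ((p : ℝ)⁻¹) ^ n = hloc n p * ((p : ℝ)⁻¹ - 1) + 1 := by rw [h]; ring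
  rw [h']
  field_simp
  ring

lemma tsum_gfun_norm (n p : ℕ) (hp : p.Prime) (hn : 2 ≤ n) :
    ∑' e, |gfun n (p ^ e)| ≤ 1 + 2 * n * (1 / (p : ℝ) ^ 2) := by
  rw [tsum_eq_sum (s := Finset.range 3) (fun e he => by rw [gfun_pow_zero n p hp e he, abs_zero])]
  have hp0 : 0 < (p : ℝ) := by exact_mod_cast hp.pos
  simp only [Finset.sum_range_succ, Finset.sum_range_zero, pow_zero, gfun_one, pow_one]
  simp only [gfun, kfun_p n p hp, kfun_p2 n p hp]
  push_cast
  rw [abs_div, abs_div, abs_neg, abs_of_nonneg (hloc_nonneg n p), abs_of_pos hp0,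
    abs_of_pos (by positivity : (0 : ℝ) < (p : ℝ) ^ 2)]
  have h1 : |hloc n p - 1| / p ≤ n * (1 / (p : ℝ) ^ 2) := by
    calc _ ≤ (n * (p : ℝ)⁻¹) / p := by gcongr; exact hloc_sub_one n p hn hp
      _ = _ := by field_simp
  have h2 : hloc n p / (p : ℝ) ^ 2 ≤ n * (1 / (p : ℝ) ^ 2) := by
    rw [mul_one_div]; gcongr; exact hloc_le n p hp
  simp only [abs_one]
  linarith

lemma summable_gfun (n : ℕ) (hn : 2 ≤ n) : Summable (fun d => |gfun n d|) := by
  have hs2 : Summable (fun m : ℕ => 2 * (n : ℝ) * (1 / (m : ℝ) ^ 2)) :=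
    hasSum_zeta_two.summable.mul_left _
  apply summable_of_sum_range_le (c := Real.exp (∑' m : ℕ, 2 * (n : ℝ) * (1 / (m : ℝ) ^ 2)))
  · intro d; positivity
  intro N
  have hsp : ∀ {p : ℕ}, p.Prime → Summable (fun e : ℕ => ‖|gfun n (p ^ e)|‖) := by
    intro p hp
    apply summable_of_ne_finset_zero (s := Finset.range 3)
    intro e he
    rw [gfun_pow_zero n p hp e he]; simp
  obtain ⟨h1, h2⟩ := EulerProduct.summable_and_hasSum_smoothNumbers_prod_primesBelow_tsum
    (f := fun d => |gfun n d|) (by simp [gfun_one])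
    (by intro a b h; rw [gfun_mul n h, abs_mul]) hsp N
  have hprod : ∏ p ∈ N.primesBelow, ∑' e : ℕ, |gfun n (p ^ e)| ≤
      Real.exp (∑' m : ℕ, 2 * (n : ℝ) * (1 / (m : ℝ) ^ 2)) := by
    calc _ ≤ ∏ p ∈ N.primesBelow, Real.exp (2 * (n : ℝ) * (1 / (p : ℝ) ^ 2)) := by
          apply Finset.prod_le_prod
          · intro p _; exact tsum_nonneg fun e => abs_nonneg _
          · intro p hp
            have h := tsum_gfun_norm n p (Nat.prime_of_mem_primesBelow hp) hn
            have := Real.add_one_le_exp (2 * (n : ℝ) * (1 / (p : ℝ) ^ 2))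
            linarith
      _ = Real.exp (∑ p ∈ N.primesBelow, 2 * (n : ℝ) * (1 / (p : ℝ) ^ 2)) :=
          (Real.exp_sum _ _).symm
      _ ≤ _ := by
          apply Real.exp_le_exp.2
          exact hs2.sum_le_tsum _ (fun i _ => by positivity)
  refine le_trans ?_ hprod
  rw [← h2.tsum_eq]
  have h3 : ∑ i ∈ Finset.range N, |gfun n i| = ∑ i ∈ (Finset.range N).filter (· ≠ 0), |gfun n i| := by
    rw [Finset.sum_filter]
    refine Finset.sum_congr rfl fun i _ => ?_
    by_cases hi : i = 0
    · simp [hi, gfun_zero]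
    · simp [hi]
  rw [h3]
  have h4 : ∀ i ∈ (Finset.range N).filter (· ≠ 0), i ∈ N.smoothNumbers := by
    intro i hi
    simp only [Finset.mem_filter, Finset.mem_range] at hi
    exact Nat.mem_smoothNumbers_of_lt (Nat.pos_of_ne_zero hi.2) hi.1
  rw [← Finset.sum_subtype_of_mem (fun i => |gfun n i|) h4]
  exact h2.summable.sum_le_tsum _ (fun i _ => abs_nonneg _)

noncomputable def invSq : ℕ →*₀ ℝ where
  toFun m := 1 / (m : ℝ) ^ 2
  map_zero' := by simp
  map_one' := by simp
  map_mul' a b := by push_cast; rw [mul_pow, one_div_mul_one_div]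

lemma tsum_gfun (n : ℕ) (hn : 2 ≤ n) : ∑' d, gfun n d = rhoN n := by
  have h1 : HasProd (fun p : Nat.Primes => 1 - ((p : ℝ)⁻¹) ^ (n + 1)) (∑' d, gfun n d) := by
    have := EulerProduct.eulerProduct_hasProd (f := gfun n) (gfun_one n)
      (fun h => gfun_mul n h) (summable_gfun n hn) (gfun_zero n)
    convert! this using 2 with p
    exact (tsum_gfun_pow n p p.2 hn).symm
  have h2 : HasProd (fun p : Nat.Primes => (1 - 1 / (p : ℝ) ^ 2)⁻¹) (Real.pi ^ 2 / 6) := by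
    have hs : Summable (fun m => ‖invSq m‖) := hasSum_zeta_two.summable.norm
    have := EulerProduct.eulerProduct_completely_multiplicative_hasProd hs
    rw [show ∑' m, invSq m = Real.pi ^ 2 / 6 from hasSum_zeta_two.tsum_eq] at this
    exact this
  have h3 := h2.mul h1
  rw [rhoN]
  have h4 : ∏' p : Nat.Primes,
      (1 + ((p : ℝ) ^ (n - 1) - 1) / ((p : ℝ) ^ (n + 1) - (p : ℝ) ^ (n - 1))) =
      Real.pi ^ 2 / 6 * ∑' d, gfun n d := by
    rw [← h3.tprod_eq]
    refine tprod_congr fun p => ?_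
    obtain ⟨k, rfl⟩ : ∃ k, n = k + 1 := ⟨n - 1, by omega⟩
    have hp1 : (1 : ℝ) < p := by exact_mod_cast p.2.one_lt
    have hp0 : (p : ℝ) ≠ 0 := by positivity
    have hp2 : (p : ℝ) ^ 2 - 1 ≠ 0 := by nlinarith
    have e1 : (p : ℝ) ^ (k + 1 + 1) - (p : ℝ) ^ (k + 1 - 1) = (p : ℝ) ^ k * ((p : ℝ) ^ 2 - 1) := by
      simp only [Nat.add_sub_cancel]; ring
    have e2 : (1 - 1 / (p : ℝ) ^ 2)⁻¹ = (p : ℝ) ^ 2 / ((p : ℝ) ^ 2 - 1) := by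
      rw [one_sub_div (by positivity), inv_div]
    rw [e1, e2]
    simp only [Nat.add_sub_cancel, inv_pow]
    field_simp
    ring
  rw [h4]
  have := Real.pi_ne_zero
  field_simp

lemma S_lower (n N : ℕ) (hn : 1 ≤ n) :
    (N : ℝ) ^ n ≤ n * ∑ e ∈ Finset.Ioc 0 N, (e : ℝ) ^ (n - 1) := by
  obtain ⟨k, rfl⟩ : ∃ k, n = k + 1 := ⟨n - 1, by omega⟩
  simp only [Nat.add_sub_cancel]
  induction N with
  | zero => simp
  | succ N ih =>
    rw [Finset.sum_Ioc_succ_top (Nat.zero_le N), mul_add]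
    have hb := one_add_mul_le_pow (a := -(1 / ((N : ℝ) + 1))) (by
      have : 1 / ((N : ℝ) + 1) ≤ 1 := by
        rw [div_le_one (by positivity)]; linarith [(Nat.cast_nonneg N : (0 : ℝ) ≤ N)]
      linarith) (k + 1)
    have h0 : (0 : ℝ) < (N : ℝ) + 1 := by positivity
    have h1 : 1 + -(1 / ((N : ℝ) + 1)) = N / (N + 1) := by field_simp; ring
    rw [h1, div_pow, le_div_iff₀ (by positivity)] at hb
    have h2 : (1 + ((k + 1 : ℕ) : ℝ) * -(1 / ((N : ℝ) + 1))) * ((N : ℝ) + 1) ^ (k + 1) =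
      ((N : ℝ) + 1) ^ (k + 1) - ((k + 1 : ℕ) : ℝ) * ((N : ℝ) + 1) ^ k := by
      field_simp; ring
    rw [h2] at hb
    push_cast at *
    linarith

lemma S_upper (n N : ℕ) (hn : 1 ≤ n) :
    n * ∑ e ∈ Finset.Ioc 0 N, (e : ℝ) ^ (n - 1) ≤ ((N : ℝ) + 1) ^ n := by
  obtain ⟨k, rfl⟩ : ∃ k, n = k + 1 := ⟨n - 1, by omega⟩
  simp only [Nat.add_sub_cancel]
  induction N with
  | zero => simp
  | succ N ih =>
    rw [Finset.sum_Ioc_succ_top (Nat.zero_le N), mul_add]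
    have h0 : (0 : ℝ) < (N : ℝ) + 1 := by positivity
    have hb := one_add_mul_le_pow (a := 1 / ((N : ℝ) + 1)) (by
      have : 0 ≤ 1 / ((N : ℝ) + 1) := by positivity
      linarith) (k + 1)
    have h1 : 1 + (1 / ((N : ℝ) + 1)) = (N + 1 + 1) / (N + 1) := by field_simp
    rw [h1, div_pow, le_div_iff₀ (by positivity)] at hb
    have h2 : (1 + ((k + 1 : ℕ) : ℝ) * (1 / ((N : ℝ) + 1))) * ((N : ℝ) + 1) ^ (k + 1) =
      ((N : ℝ) + 1) ^ (k + 1) + ((k + 1 : ℕ) : ℝ) * ((N : ℝ) + 1) ^ k := by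
      field_simp; ring
    rw [h2] at hb
    push_cast at *
    linarith

lemma S_le (n N : ℕ) (hn : 1 ≤ n) :
    ∑ e ∈ Finset.Ioc 0 N, (e : ℝ) ^ (n - 1) ≤ (N : ℝ) ^ n := by
  calc _ ≤ ∑ e ∈ Finset.Ioc 0 N, (N : ℝ) ^ (n - 1) := by
        apply Finset.sum_le_sum
        intro e he
        have : e ≤ N := (Finset.mem_Ioc.1 he).2
        gcongr
    _ = _ := by
      simp only [Finset.sum_const, Nat.card_Ioc, nsmul_eq_mul, Nat.sub_zero]
      rw [← pow_succ', Nat.sub_add_cancel hn]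

noncomputable def Sx (n : ℕ) (x : ℝ) : ℝ :=
  n * (∑ e ∈ Finset.Ioc 0 ⌊x⌋₊, (e : ℝ) ^ (n - 1)) / x ^ n

lemma Sx_tendsto (n : ℕ) (hn : 1 ≤ n) : Tendsto (Sx n) atTop (nhds 1) := by
  have h1 : Tendsto (fun x : ℝ => ((⌊x⌋₊ : ℝ) / x) ^ n) atTop (nhds 1) := by
    simpa using (tendsto_nat_floor_div_atTop (R := ℝ)).pow n
  have h2 : Tendsto (fun x : ℝ => ((⌊x⌋₊ : ℝ) / x + 1 / x) ^ n) atTop (nhds 1) := by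
    have := ((tendsto_nat_floor_div_atTop (R := ℝ)).add
      (tendsto_const_nhds (x := (1 : ℝ)).div_atTop tendsto_id)).pow n
    simpa using this
  refine tendsto_of_tendsto_of_tendsto_of_le_of_le' h1 h2 ?_ ?_
  · filter_upwards [eventually_gt_atTop 0] with x hx
    rw [Sx, div_pow]
    gcongr
    exact S_lower n _ hn
  · filter_upwards [eventually_gt_atTop 0] with x hx
    rw [Sx, ← add_div, div_pow]
    gcongr
    exact S_upper n _ hn

lemma Sx_bound (n : ℕ) (hn : 1 ≤ n) (x : ℝ) (hx : 0 ≤ x) : |Sx n x| ≤ n := by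
  have h0 : 0 ≤ ∑ e ∈ Finset.Ioc 0 ⌊x⌋₊, (e : ℝ) ^ (n - 1) := by positivity
  rw [abs_of_nonneg (by unfold Sx; positivity), Sx, mul_div_assoc]
  apply mul_le_of_le_one_right (by positivity)
  apply div_le_one_of_le₀ _ (by positivity)
  refine (S_le n _ hn).trans ?_
  gcongr
  exact Nat.floor_le hx

lemma sum_conv (n N : ℕ) :
    ∑ m ∈ Finset.Ioc 0 N, (m : ℝ) ^ (n - 1) * Hfun n m =
      ∑ d ∈ Finset.Ioc 0 N, (d : ℝ) ^ (n - 1) * kfun n d *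
        ∑ e ∈ Finset.Ioc 0 (N / d), (e : ℝ) ^ (n - 1) := by
  let P : ArithmeticFunction ℝ := ⟨fun m => if m = 0 then 0 else (m : ℝ) ^ (n - 1), by simp⟩
  let K : ArithmeticFunction ℝ := ⟨fun d => (d : ℝ) ^ (n - 1) * kfun n d, by simp⟩
  have hP : ∀ m ≠ 0, P m = (m : ℝ) ^ (n - 1) := fun m hm => by simp [P, hm]
  have h := ArithmeticFunction.sum_Ioc_mul_eq_sum_sum K P N
  have hl : ∀ m ∈ Finset.Ioc 0 N, (K * P) m = (m : ℝ) ^ (n - 1) * Hfun n m := by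
    intro m hm
    rw [ArithmeticFunction.mul_apply, ← sum_kfun, Finset.mul_sum,
      ← Nat.sum_divisorsAntidiagonal (fun i _ => (m : ℝ) ^ (n - 1) * kfun n i)]
    refine Finset.sum_congr rfl fun x hx => ?_
    obtain ⟨hx1, hx2⟩ := Nat.mem_divisorsAntidiagonal.1 hx
    rw [hP _ (by rintro h; simp [h] at hx1; omega)]
    simp only [K, ArithmeticFunction.coe_mk]
    rw [← hx1]; push_cast; rw [mul_pow]; ring
  rw [Finset.sum_congr rfl hl] at h
  rw [h]
  refine Finset.sum_congr rfl fun d _ => ?_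
  congr 1
  refine Finset.sum_congr rfl fun e he => hP e ?_
  have := (Finset.mem_Ioc.1 he).1
  omega

lemma sum_eq_tsum (n : ℕ) (hn : 2 ≤ n) (V : ℝ) (hV : 0 < V) :
    (∑ m ∈ Finset.Ioc 0 ⌊V⌋₊, (m : ℝ) ^ (n - 1) * Hfun n m) * n / V ^ n =
      ∑' d : ℕ, gfun n d * Sx n (V / d) := by
  rw [tsum_eq_sum (s := Finset.Ioc 0 ⌊V⌋₊), sum_conv, Finset.sum_mul, Finset.sum_div]
  · refine Finset.sum_congr rfl fun d hd => ?_
    have hd0 : (d : ℝ) ≠ 0 := by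
      have := (Finset.mem_Ioc.1 hd).1; positivity
    rw [gfun, Sx, Nat.floor_div_natCast]
    obtain ⟨k, rfl⟩ : ∃ k, n = k + 1 := ⟨n - 1, by omega⟩
    simp only [Nat.add_sub_cancel, div_pow]
    field_simp
    ring
  · intro d hd
    by_cases h0 : d = 0
    · simp [h0, gfun_zero]
    have : ⌊V / d⌋₊ = 0 := by
      rw [Nat.floor_div_natCast]
      apply Nat.div_eq_of_lt
      simp only [Finset.mem_Ioc, not_and, not_le] at hd
      exact hd (Nat.pos_of_ne_zero h0)
    simp [Sx, this]

lemma main_tendsto (n : ℕ) (hn : 2 ≤ n) :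
    Tendsto (fun V : ℝ => (∑ m ∈ Finset.Ioc 0 ⌊V⌋₊, (m : ℝ) ^ (n - 1) * Hfun n m) * n / V ^ n)
      atTop (nhds (rhoN n)) := by
  rw [← tsum_gfun n hn]
  have h : Tendsto (fun V : ℝ => ∑' d : ℕ, gfun n d * Sx n (V / d)) atTop
      (nhds (∑' d, gfun n d)) := by
    apply tendsto_tsum_of_dominated_convergence (bound := fun d => |gfun n d| * n)
      ((summable_gfun n hn).mul_right _)
    · intro d
      by_cases h0 : d = 0
      · simp [h0, gfun_zero]
      have hd : (0 : ℝ) < d := by positivity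
      have := ((Sx_tendsto n (by omega)).comp (tendsto_id.atTop_div_const hd)).const_mul (gfun n d)
      simpa using this
    · filter_upwards [eventually_gt_atTop 0] with V hV d
      rw [Real.norm_eq_abs, abs_mul]
      gcongr
      exact Sx_bound n (by omega) _ (by positivity)
  refine h.congr' ?_
  filter_upwards [eventually_gt_atTop 0] with V hV
  exact (sum_eq_tsum n hn V hV).symm

lemma pow_mul_Hfun (n m : ℕ) (hn : 2 ≤ n) (hsq : Squarefree m) :
    (m : ℝ) ^ (n - 1) * Hfun n m =
      ∏ p ∈ m.primeFactors, ∑ i ∈ Finset.range n, (p : ℝ) ^ i := by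
  simp only [Hfun, ArithmeticFunction.coe_mk, hsq, if_true]
  conv_lhs => rw [← Nat.prod_primeFactors_of_squarefree hsq]
  rw [Nat.prod_primeFactors_of_squarefree hsq]
  have h1 : (m : ℝ) = ∏ p ∈ m.primeFactors, (p : ℝ) := by
    conv_lhs => rw [← Nat.prod_primeFactors_of_squarefree hsq]
    push_cast; rfl
  rw [h1, ← Finset.prod_pow, ← Finset.prod_mul_distrib]
  refine Finset.prod_congr rfl fun p hp => ?_
  have hp0 : (p : ℝ) ≠ 0 := by exact_mod_cast (Nat.prime_of_mem_primeFactors hp).ne_zero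
  rw [hloc, Finset.mul_sum, ← Finset.sum_range_reflect]
  refine Finset.sum_congr rfl fun i hi => ?_
  have := Finset.mem_range.1 hi
  rw [inv_pow, mul_inv_eq_iff_eq_mul₀ (by positivity), ← pow_add]
  congr 1
  omega

theorem squarefree_index_asymptotic (n : ℕ) (hn : 2 ≤ n) :
    Tendsto (fun V : ℝ => (squarefreeIndexCount n V : ℝ) * n / V ^ n) atTop
      (nhds (rhoN n)) := by
  refine (main_tendsto n hn).congr' ?_
  filter_upwards [eventually_ge_atTop 0] with V hV
  congr 2
  rw [squarefreeIndexCount, count_eq_s2 n V hV]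
  push_cast
  refine Finset.sum_congr rfl fun m _ => ?_
  by_cases hsq : Squarefree m
  · rw [if_pos hsq, idxCount_eq n m hsq, pow_mul_Hfun n m hn hsq]
  · simp [hsq, Hfun]
end
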